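/- For every integer n ≥ 1, the 3-coloring of Q_n that assigns color 1 to every vertex a_i (1 ≤ i ≤ n), color 2 to every vertex b_i (1 ≤ i ≤ n), and color 3 to every vertex c_i (0 ≤ i ≤ n) is a strong conflict-free vertex-connection 3-coloring of Q_n; in particular svcfc(Q_n) ≤ 3. -/

import Mathlib

open SimpleGraph

/-- `f` is a strong conflict-free vertex-connection coloring of `G`: any two distinct
vertices are joined by a shortest path on which some color occurs exactly once. -/
def IsSCFVC {V α : Type*} [DecidableEq α] (G : SimpleGraph V) (f : V → α) : Prop :=
  ∀ u v : V, u ≠ v → ∃ p : G.Walk u v, p.length = G.dist u v ∧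
    ∃ c : α, (p.support.map f).count c = 1

/-- The strong conflict-free vertex-connection number. -/
noncomputable def svcfc {V : Type*} (G : SimpleGraph V) : ℕ :=
  sInf {k | ∃ f : V → Fin k, IsSCFVC G f}

/-- Vertices of the graph `Q n`: `A i`, `B i` are `a_{i+1}`, `b_{i+1}` for `i : Fin n`,
and `C j` is `c_j` for `j : Fin (n+1)`. -/
inductive QV (n : ℕ) where
  | A : Fin n → QV n
  | B : Fin n → QV n
  | C : Fin (n + 1) → QV n
deriving DecidableEq

/-- The graph `Q n`, with edges `c_{i-1}a_i`, `c_i a_i`, `c_{i-1}b_i`, `c_i b_i`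
and `a_i b_i` for `1 ≤ i ≤ n`. -/
def Qgraph (n : ℕ) : SimpleGraph (QV n) :=
  SimpleGraph.fromRel (fun x y =>
    match x, y with
    | .A i, .B j => i.val = j.val
    | .A i, .C j => j.val = i.val ∨ j.val = i.val + 1
    | .B i, .C j => j.val = i.val ∨ j.val = i.val + 1
    | _, _ => False)

def QC {n : ℕ} (x : QV n) : Fin 3 :=
  QV.casesOn x (fun _ => 0) (fun _ => 1) (fun _ => 2)

def QS {n : ℕ} (s : Bool) (i : Fin n) : QV n := if s then .B i else .A i

def sc (s : Bool) : Fin 3 := if s then 1 else 0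

def qpos {n : ℕ} (x : QV n) : ℤ :=
  QV.casesOn x (fun i => 2 * i.val + 1) (fun i => 2 * i.val + 1) (fun i => 2 * i.val)

def QP {n : ℕ} (u v : QV n) (l : ℕ) (c : Fin 3) (k : ℕ) : Prop :=
  ∃ p : (Qgraph n).Walk u v, p.length = l ∧ (p.support.map QC).count c = k

theorem QC_QS {n : ℕ} (s : Bool) (i : Fin n) : QC (QS s i) = sc s := by
  cases s <;> rfl

theorem qpos_QS {n : ℕ} (s : Bool) (i : Fin n) : qpos (QS s i) = 2 * i.val + 1 := by
  cases s <;> rfl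

theorem sc_ne (s t : Bool) (h : s ≠ t) : sc s ≠ sc t := by
  revert s t; decide

theorem sc_ne_two (s : Bool) : sc s ≠ 2 := by
  revert s; decide

theorem QP.symm {n : ℕ} {u v : QV n} {l c k} (h : QP u v l c k) : QP v u l c k := by
  obtain ⟨p, h1, h2⟩ := h
  exact ⟨p.reverse, by simpa using h1, by simpa [Walk.support_reverse] using h2⟩

theorem QP.cons {n : ℕ} {u v w : QV n} {l c k} (h : QP v w l c k) (a : (Qgraph n).Adj u v) :
    QP u w (l + 1) c (k + if QC u = c then 1 else 0) := by
  obtain ⟨p, h1, h2⟩ := h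
  refine ⟨Walk.cons a p, by simpa using h1, ?_⟩
  rw [Walk.support_cons, List.map_cons, List.count_cons, h2]
  simp

theorem QP.concat {n : ℕ} {u v w : QV n} {l c k} (h : QP u v l c k) (a : (Qgraph n).Adj v w) :
    QP u w (l + 1) c (k + if QC w = c then 1 else 0) :=
  (h.symm.cons a.symm).symm

theorem QP.nil {n : ℕ} (u : QV n) (c) : QP u u 0 c (if QC u = c then 1 else 0) :=
  ⟨Walk.nil, rfl, by simp [List.count_singleton]⟩

theorem adj_SC {n : ℕ} (s : Bool) (i : Fin n) (j : Fin (n + 1))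
    (h : j.val = i.val ∨ j.val = i.val + 1) : (Qgraph n).Adj (QS s i) (.C j) := by
  cases s <;> simp [QS, Qgraph, SimpleGraph.fromRel_adj, h]

theorem adj_SS {n : ℕ} (s t : Bool) (i : Fin n) (h : s ≠ t) :
    (Qgraph n).Adj (QS s i) (QS t i) := by
  cases s <;> cases t <;> simp_all [QS, Qgraph, SimpleGraph.fromRel_adj]

theorem qpos_adj {n : ℕ} {u v : QV n} (h : (Qgraph n).Adj u v) : qpos v - qpos u ≤ 1 := by
  cases u <;> cases v <;> simp [Qgraph, SimpleGraph.fromRel_adj] at h <;> simp only [qpos] <;> omega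

theorem qpos_walk {n : ℕ} {u v : QV n} (p : (Qgraph n).Walk u v) :
    qpos v - qpos u ≤ p.length := by
  induction p with
  | nil => simp
  | cons a p ih =>
    have := qpos_adj a
    rw [Walk.length_cons]; push_cast; omega

theorem L1 {n : ℕ} (s : Bool) (c : Fin 3) (hc : c ≠ 2) (hs : sc s ≠ c) (d : ℕ) :
    ∀ i j : Fin (n + 1), j.val = i.val + d → QP (n := n) (.C i) (.C j) (2 * d) c 0 := by
  have h2 : ∀ i, QC (n := n) (.C i) ≠ c := fun i => hc.symm
  induction d with
  | zero =>
    intro i j h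
    obtain rfl : j = i := Fin.ext h
    simpa [h2] using QP.nil (.C j) c
  | succ d ih =>
    intro i j h
    have hj := j.isLt
    have a := ih ⟨i.val + 1, by omega⟩ j (by simp only; omega)
    have b := a.cons (adj_SC s ⟨i.val, by omega⟩ _ (Or.inr rfl))
    have e := b.cons (adj_SC s ⟨i.val, by omega⟩ i (Or.inl rfl)).symm
    simpa [h2, QC_QS, hs, Nat.mul_add] using e

theorem L2 {n : ℕ} (s : Bool) (d : ℕ) (i j : Fin (n + 1)) (h : j.val = i.val + d + 1) :
    QP (n := n) (.C i) (.C j) (2 * d + 2) (sc s) 1 := by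
  have h2 : ∀ i, QC (n := n) (.C i) ≠ sc s := fun i => (sc_ne_two s).symm
  have hj := j.isLt
  have a := L1 (n := n) (!s) (sc s) (sc_ne_two s) (sc_ne _ _ (by simp)) d
    ⟨i.val + 1, by omega⟩ j (by simp only; omega)
  have b := a.cons (adj_SC s ⟨i.val, by omega⟩ _ (Or.inr rfl))
  have e := b.cons (adj_SC s ⟨i.val, by omega⟩ i (Or.inl rfl)).symm
  simpa [h2, QC_QS] using e

/-- The pair is joined by a short enough walk with a color occurring once. -/
def Good {n : ℕ} (u v : QV n) : Prop :=
  ∃ l c, QP u v l c 1 ∧ ((l : ℤ) ≤ 1 ∨ (l : ℤ) ≤ qpos v - qpos u)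

theorem good_CC {n : ℕ} (i j : Fin (n + 1)) (h : i.val < j.val) : Good (n := n) (.C i) (.C j) := by
  obtain ⟨d, hd⟩ := Nat.exists_eq_add_of_lt h
  refine ⟨_, _, L2 true d i j hd, Or.inr ?_⟩
  simp only [qpos]; push_cast; omega

theorem good_CS {n : ℕ} (s : Bool) (i : Fin (n + 1)) (j : Fin n) (h : i.val ≤ j.val) :
    Good (n := n) (.C i) (QS s j) := by
  obtain ⟨d, hd⟩ := Nat.exists_eq_add_of_le h
  have a := L1 (n := n) (!s) (sc s) (sc_ne_two s) (sc_ne _ _ (by simp)) d i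
    ⟨j.val, by omega⟩ hd
  have b := a.concat (adj_SC s j _ (Or.inl rfl)).symm
  refine ⟨2 * d + 1, sc s, by simpa [QC_QS] using b, Or.inr ?_⟩
  rw [qpos_QS]; simp only [qpos]; push_cast; omega

theorem good_SC {n : ℕ} (s : Bool) (i : Fin n) (j : Fin (n + 1)) (h : i.val < j.val) :
    Good (n := n) (QS s i) (.C j) := by
  obtain ⟨d, hd⟩ := Nat.exists_eq_add_of_lt h
  have a := L1 (n := n) (!s) (sc s) (sc_ne_two s) (sc_ne _ _ (by simp)) d
    ⟨i.val + 1, by omega⟩ j (by simp only; omega)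
  have b := a.cons (adj_SC s i _ (Or.inr rfl))
  refine ⟨2 * d + 1, sc s, by simpa [QC_QS] using b, Or.inr ?_⟩
  rw [qpos_QS]; simp only [qpos]; push_cast; omega

theorem good_SS {n : ℕ} (s t : Bool) (i j : Fin n) (h : i.val < j.val) :
    Good (n := n) (QS s i) (QS t j) := by
  obtain ⟨d, hd⟩ := Nat.exists_eq_add_of_lt h
  have hl : ((2 * d + 2 : ℕ) : ℤ) ≤ qpos (QS t j) - qpos (QS s i) := by
    rw [qpos_QS, qpos_QS]; push_cast; omega
  by_cases hst : s = t
  · subst hst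
    rcases d with _ | d
    · have hC : ∀ k, QC (n := n) (.C k) = 2 := fun _ => rfl
      have a := QP.nil (n := n) (.C ⟨j.val, by omega⟩) 2
      have b := a.cons (adj_SC s i _ (Or.inr (by simp only; omega)))
      have e := b.concat (adj_SC s j _ (Or.inl rfl)).symm
      exact ⟨2, 2, by simpa [QC_QS, sc_ne_two, hC] using e, Or.inr hl⟩
    · have a := L2 (n := n) (!s) d ⟨i.val + 1, by omega⟩ ⟨j.val, by omega⟩ (by simp only; omega)
      have b := a.cons (adj_SC s i _ (Or.inr rfl))
      have e := b.concat (adj_SC s j _ (Or.inl rfl)).symm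
      have hne : sc s ≠ sc (!s) := sc_ne _ _ (by simp)
      exact ⟨2 * (d + 1) + 2, sc (!s), by simpa [QC_QS, hne, Nat.mul_add] using e, Or.inr hl⟩
  · have hne : sc t ≠ sc s := sc_ne _ _ (Ne.symm hst)
    have a := L1 (n := n) t (sc s) (sc_ne_two s) hne d
      ⟨i.val + 1, by omega⟩ ⟨j.val, by omega⟩ (by simp only; omega)
    have b := a.cons (adj_SC s i _ (Or.inr rfl))
    have e := b.concat (adj_SC t j _ (Or.inl rfl)).symm
    exact ⟨2 * d + 2, sc s, by simpa [QC_QS, hne] using e, Or.inr hl⟩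

theorem good_SS' {n : ℕ} (s t : Bool) (i : Fin n) (h : s ≠ t) :
    Good (n := n) (QS s i) (QS t i) := by
  have a := (QP.nil (QS t i) (sc s)).cons (adj_SS s t i h)
  have hne : sc t ≠ sc s := sc_ne _ _ (Ne.symm h)
  exact ⟨1, sc s, by simpa [QC_QS, hne] using a, Or.inl (by simp)⟩

theorem QV_cases {n : ℕ} (u : QV n) : (∃ s i, u = QS s i) ∨ ∃ i, u = .C i := by
  cases u with
  | A i => exact Or.inl ⟨false, i, rfl⟩
  | B i => exact Or.inl ⟨true, i, rfl⟩
  | C i => exact Or.inr ⟨i, rfl⟩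

theorem good_all {n : ℕ} (u v : QV n) (h : u ≠ v) : Good u v ∨ Good v u := by
  rcases QV_cases u with ⟨s, i, rfl⟩ | ⟨i, rfl⟩ <;> rcases QV_cases v with ⟨t, j, rfl⟩ | ⟨j, rfl⟩
  · rcases lt_trichotomy i.val j.val with h1 | h1 | h1
    · exact Or.inl (good_SS s t i j h1)
    · obtain rfl : i = j := Fin.ext h1
      exact Or.inl (good_SS' s t i (fun e => h (by rw [e])))
    · exact Or.inr (good_SS t s j i h1)
  · rcases Nat.lt_or_ge i.val j.val with h1 | h1
    · exact Or.inl (good_SC s i j h1)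
    · exact Or.inr (good_CS s j i h1)
  · rcases Nat.lt_or_ge j.val i.val with h1 | h1
    · exact Or.inr (good_SC t j i h1)
    · exact Or.inl (good_CS t i j h1)
  · rcases lt_trichotomy i.val j.val with h1 | h1 | h1
    · exact Or.inl (good_CC i j h1)
    · exact absurd (by rw [Fin.ext h1]) h
    · exact Or.inr (good_CC j i h1)

theorem good_spec {n : ℕ} {u v : QV n} (h : u ≠ v) (g : Good u v) :
    ∃ p : (Qgraph n).Walk u v, p.length = (Qgraph n).dist u v ∧
      ∃ c, (p.support.map QC).count c = 1 := by
  obtain ⟨l, c, ⟨p, rfl, hc⟩, hl⟩ := g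
  refine ⟨p, le_antisymm ?_ (dist_le p), c, hc⟩
  obtain ⟨q, hq⟩ := p.reachable.exists_walk_length_eq_dist
  have h1 := qpos_walk q
  have h2 := p.reachable.pos_dist_of_ne h
  omega

theorem main_QC (n : ℕ) : IsSCFVC (Qgraph n) QC := by
  intro u v h
  rcases good_all u v h with g | g
  · exact good_spec h g
  · obtain ⟨p, h1, c, h2⟩ := good_spec h.symm g
    obtain ⟨q, h3, h4⟩ := QP.symm ⟨p, h1, h2⟩
    exact ⟨q, by rw [h3, dist_comm], c, h4⟩

/-- The coloring of `Q n` giving all `a_i` one color, all `b_i` a second color and all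
`c_i` a third color is a strong conflict-free vertex-connection `3`-coloring;
in particular `svcfc (Q n) ≤ 3`. -/
theorem stmt6 (n : ℕ) (hn : 1 ≤ n) :
    IsSCFVC (Qgraph n) (fun x =>
      match x with
      | .A _ => (0 : Fin 3)
      | .B _ => 1
      | .C _ => 2) ∧
    svcfc (Qgraph n) ≤ 3 := by
  have h : IsSCFVC (Qgraph n) (fun x =>
      match x with
      | .A _ => (0 : Fin 3)
      | .B _ => 1
      | .C _ => 2) := by
    convert main_QC n using 1
    funext x
    cases x <;> rfl
  exact ⟨h, Nat.sInf_le ⟨_, h⟩⟩
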